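/- arXiv:2604.20754 — 3 statements merged into one kernel-verified Lean document; each statement's English description precedes it below -/
import Mathlib

section
/- Let R be a terminating right-linear overlay term rewrite system. For all terms s and t, if s →_R* t and t is a normal form of R, then s i→_R* t, i.e., t is reachable from s by innermost rewriting. -/
namespace RWS

/-- First-order terms over a signature `F` (function symbols of arbitrary arity,
realized by lists of arguments) and variables `V`. -/
inductive Term (F V : Type) : Type
  | var : V → Term F V
  | app : F → List (Term F V) → Term F V

namespace Term

variable {F V : Type}

/-- `t` is a variable. -/
def IsVar : Term F V → Prop
  | var _ => True
  | app _ _ => False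

/-- Application of a substitution (a map from variables to terms) to a term. -/
def subst (σ : V → Term F V) : Term F V → Term F V
  | var x => σ x
  | app f ts => app f (ts.attach.map fun t => t.1.subst σ)
decreasing_by
  simp_wf
  have := List.sizeOf_lt_of_mem t.2
  omega

/-- The list of variable occurrences of a term. -/
def varOccs : Term F V → List V
  | var x => [x]
  | app _ ts => (ts.attach.map fun t => t.1.varOccs).flatten
decreasing_by
  simp_wf
  have := List.sizeOf_lt_of_mem t.2
  omega

/-- A term is linear if no variable occurs in it more than once. -/
def Linear (t : Term F V) : Prop := t.varOccs.Nodup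

end Term

variable {F V : Type}

/-- `PSub t u` : `t` is a proper subterm of `u` (i.e. `u ▷ t`). -/
inductive PSub : Term F V → Term F V → Prop
  | head {t f ts} : t ∈ ts → PSub t (.app f ts)
  | tail {t u f ts} : PSub t u → u ∈ ts → PSub t (.app f ts)

/-- Subterm-or-equal relation. -/
def Sub (t u : Term F V) : Prop := t = u ∨ PSub t u

/-- The rewrite relation of a set `R` of rewrite rules: contraction of a redex
at some position (root rule instance, closed under contexts). -/
inductive Rew (R : Set (Term F V × Term F V)) : Term F V → Term F V → Prop
  | root {l r : Term F V} {σ : V → Term F V} :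
      (l, r) ∈ R → Rew R (l.subst σ) (r.subst σ)
  | congr {s t : Term F V} {f : F} {ts us : List (Term F V)} :
      Rew R s t → Rew R (.app f (ts ++ s :: us)) (.app f (ts ++ t :: us))

/-- `t` is a normal form of `R`. -/
def NormalForm (R : Set (Term F V × Term F V)) (t : Term F V) : Prop :=
  ∀ u, ¬ Rew R t u

/-- Innermost rewriting: contraction of a redex all of whose proper subterms
are normal forms of `R`. -/
inductive IRew (R : Set (Term F V × Term F V)) : Term F V → Term F V → Prop
  | root {l r : Term F V} {σ : V → Term F V} :
      (l, r) ∈ R → (∀ u, PSub u (l.subst σ) → NormalForm R u) →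
      IRew R (l.subst σ) (r.subst σ)
  | congr {s t : Term F V} {f : F} {ts us : List (Term F V)} :
      IRew R s t → IRew R (.app f (ts ++ s :: us)) (.app f (ts ++ t :: us))

/-- A rewrite step at the root position (`→_{ε}`). -/
def RootStep (R : Set (Term F V × Term F V)) (s t : Term F V) : Prop :=
  ∃ l r σ, (l, r) ∈ R ∧ s = Term.subst σ l ∧ t = Term.subst σ r

/-- A rewrite step strictly below the root (`→_{>ε}`). -/
def BelowRew (R : Set (Term F V × Term F V)) (s t : Term F V) : Prop :=
  ∃ (f : F) (ts us : List (Term F V)) (a b : Term F V),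
    Rew R a b ∧ s = .app f (ts ++ a :: us) ∧ t = .app f (ts ++ b :: us)

/-- An innermost rewrite step strictly below the root (`i→_{>ε}`). -/
def IBelowRew (R : Set (Term F V × Term F V)) (s t : Term F V) : Prop :=
  ∃ (f : F) (ts us : List (Term F V)) (a b : Term F V),
    IRew R a b ∧ s = .app f (ts ++ a :: us) ∧ t = .app f (ts ++ b :: us)

/-- `R` is a term rewrite system: left-hand sides are not variables and
variables of right-hand sides occur in the corresponding left-hand sides. -/
def IsTRS (R : Set (Term F V × Term F V)) : Prop :=
  ∀ p ∈ R, ¬ p.1.IsVar ∧ ∀ x ∈ p.2.varOccs, x ∈ p.1.varOccs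

/-- All right-hand sides are linear. -/
def RightLinear (R : Set (Term F V × Term F V)) : Prop :=
  ∀ p ∈ R, p.2.Linear

/-- No right-hand side is a variable. -/
def NonCollapsing (R : Set (Term F V × Term F V)) : Prop :=
  ∀ p ∈ R, ¬ p.2.IsVar

/-- `R` has an inner-overlap: a proper non-variable subterm of some left-hand
side is unifiable (after renaming the rules apart, equivalently: some instance
of the one equals some instance of the other) with some left-hand side. -/
def InnerOverlap (R : Set (Term F V × Term F V)) : Prop :=
  ∃ l r l' r' u, (l, r) ∈ R ∧ (l', r') ∈ R ∧ PSub u l ∧ ¬ u.IsVar ∧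
    ∃ σ τ : V → Term F V, u.subst σ = l'.subst τ

/-- `R` is an overlay system. -/
def Overlay (R : Set (Term F V × Term F V)) : Prop := ¬ InnerOverlap R

/-- The term `t` is terminating w.r.t. `R`: no infinite rewrite sequence starts from `t`. -/
def Terminating (R : Set (Term F V × Term F V)) (t : Term F V) : Prop :=
  ¬ ∃ f : ℕ → Term F V, f 0 = t ∧ ∀ n, Rew R (f n) (f (n + 1))

/-- The TRS `R` is terminating: there is no infinite rewrite sequence. -/
def TerminatingTRS (R : Set (Term F V × Term F V)) : Prop :=
  ¬ ∃ f : ℕ → Term F V, ∀ n, Rew R (f n) (f (n + 1))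

/-- The TRS `R` is innermost terminating: there is no infinite innermost rewrite sequence. -/
def InnermostTerminatingTRS (R : Set (Term F V × Term F V)) : Prop :=
  ¬ ∃ f : ℕ → Term F V, ∀ n, IRew R (f n) (f (n + 1))

/-- Domain of a substitution. -/
def Dom (σ : V → Term F V) : Set V := {x | σ x ≠ .var x}

end RWS

namespace RWS

variable {F V : Type}

/-- Embedding of terms over the signature `F` into terms over the extended
signature `F ⊕ F`, where `Sum.inl f` is the original symbol `f` and
`Sum.inr f` is the fresh tuple symbol `f#`. -/
def Term.lift : Term F V → Term (F ⊕ F) V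
  | .var x => .var x
  | .app f ts => .app (Sum.inl f) (ts.attach.map fun t => t.1.lift)
decreasing_by
  simp_wf
  have := List.sizeOf_lt_of_mem t.2
  omega

/-- The TRS `R` viewed over the extended signature `F ⊕ F`. -/
def liftTRS (R : Set (Term F V × Term F V)) :
    Set (Term (F ⊕ F) V × Term (F ⊕ F) V) :=
  { p | ∃ l r, (l, r) ∈ R ∧ p = (l.lift, r.lift) }

/-- The defined symbols of `R`: root symbols of left-hand sides. -/
def DefinedSym (R : Set (Term F V × Term F V)) : Set F :=
  { f | ∃ ts r, (Term.app f ts, r) ∈ R }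

/-- `t#`: the term `f(t₁,…,tₙ)` with its root replaced by the tuple symbol `f#`. -/
def Term.sharp : Term F V → Term (F ⊕ F) V
  | .var x => .var x
  | .app f ts => .app (Sum.inr f) (ts.attach.map fun t => t.1.lift)

/-- The set of dependency pairs of `R`: rules `ℓ# → t#` where `ℓ → r ∈ R` and
`t` is a subterm of `r` whose root symbol is defined. -/
def DP (R : Set (Term F V × Term F V)) :
    Set (Term (F ⊕ F) V × Term (F ⊕ F) V) :=
  { p | ∃ l r t, (l, r) ∈ R ∧ Sub t r ∧
        (∃ g ts, t = Term.app g ts ∧ g ∈ DefinedSym R) ∧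
        p = (l.sharp, t.sharp) }

/-- There is an infinite minimal `(P,R)`-chain
`t₀ →_{>ε,R}* s₀ →_{ε,P} t₁ →_{>ε,R}* s₁ →_{ε,P} t₂ ⋯` (all proper subterms of
the `tᵢ` are terminating w.r.t. `R`). -/
def InfMinChain (P R : Set (Term F V × Term F V)) : Prop :=
  ∃ t s : ℕ → Term F V,
    (∀ i, Relation.ReflTransGen (BelowRew R) (t i) (s i)) ∧
    (∀ i, RootStep P (s i) (t (i + 1))) ∧
    (∀ i v, PSub v (t i) → Terminating R v)

/-- There is an infinite innermost minimal `(P,R)`-chain: as above, where the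
below-root `R`-steps are innermost and each root `P`-step is applied to a term
all of whose proper subterms are normal forms of `R`. -/
def InfInnMinChain (P R : Set (Term F V × Term F V)) : Prop :=
  ∃ t s : ℕ → Term F V,
    (∀ i, Relation.ReflTransGen (IBelowRew R) (t i) (s i)) ∧
    (∀ i v, PSub v (s i) → NormalForm R v) ∧
    (∀ i, RootStep P (s i) (t (i + 1))) ∧
    (∀ i v, PSub v (t i) → Terminating R v)

/-- Finite minimal `(P,R)`-chains of length `n` (number of root `P`-steps),
from the first term to the term reached right after the `n`-th root `P`-step. -/
inductive MinChainN (P R : Set (Term F V × Term F V)) :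
    ℕ → Term F V → Term F V → Prop
  | refl {t : Term F V} :
      (∀ v, PSub v t → Terminating R v) → MinChainN P R 0 t t
  | step {n : ℕ} {t₀ t s t' : Term F V} :
      MinChainN P R n t₀ t →
      Relation.ReflTransGen (BelowRew R) t s →
      RootStep P s t' →
      (∀ v, PSub v t' → Terminating R v) →
      MinChainN P R (n + 1) t₀ t'

/-- Finite innermost minimal `(P,R)`-chains of length `n`. -/
inductive InnMinChainN (P R : Set (Term F V × Term F V)) :
    ℕ → Term F V → Term F V → Prop
  | refl {t : Term F V} :
      (∀ v, PSub v t → Terminating R v) → InnMinChainN P R 0 t t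
  | step {n : ℕ} {t₀ t s t' : Term F V} :
      InnMinChainN P R n t₀ t →
      Relation.ReflTransGen (IBelowRew R) t s →
      (∀ v, PSub v s → NormalForm R v) →
      RootStep P s t' →
      (∀ v, PSub v t' → Terminating R v) →
      InnMinChainN P R (n + 1) t₀ t'

end RWS

namespace RWS

theorem Term.subst_app {F V : Type} (σ : V → Term F V) (f : F) (ts : List (Term F V)) :
    (Term.app f ts).subst σ = .app f (ts.map (Term.subst σ)) := by
  rw [Term.subst, List.map_attach_eq_pmap, List.pmap_eq_map]

theorem Term.varOccs_app {F V : Type} (f : F) (ts : List (Term F V)) :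
    (Term.app f ts).varOccs = (ts.map Term.varOccs).flatten := by
  rw [Term.varOccs, List.map_attach_eq_pmap, List.pmap_eq_map]

theorem Term.induct {F V : Type} {motive : Term F V → Prop}
    (var : ∀ x, motive (.var x))
    (app : ∀ f ts, (∀ t ∈ ts, motive t) → motive (.app f ts)) : ∀ t, motive t
  | .var x => var x
  | .app f ts => app f ts fun t _ => Term.induct var app t
termination_by t => sizeOf t
decreasing_by
  simp_wf
  have := List.sizeOf_lt_of_mem ‹t ∈ ts›
  omega

/-- Contexts with exactly one hole. -/
inductive Ctx (F V : Type) : Type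
  | hole : Ctx F V
  | app : F → List (Term F V) → Ctx F V → List (Term F V) → Ctx F V

/-- The term obtained by plugging `u` into the hole of a context. -/
def Ctx.fill {F V : Type} (u : Term F V) : Ctx F V → Term F V
  | .hole => u
  | .app f ts K us => .app f (ts ++ K.fill u :: us)

section Innermost

variable {F V : Type} {R : Set (Term F V × Term F V)}

theorem reflTransGen_rew_congr {s t : Term F V} (f : F) (ts us : List (Term F V))
    (h : Relation.ReflTransGen (Rew R) s t) :
    Relation.ReflTransGen (Rew R) (.app f (ts ++ s :: us)) (.app f (ts ++ t :: us)) :=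
  h.lift (fun a => Term.app f (ts ++ a :: us)) fun _ _ => Rew.congr

theorem reflTransGen_rew_app (f : F) {ts us : List (Term F V)}
    (h : List.Forall₂ (Relation.ReflTransGen (Rew R)) ts us) :
    Relation.ReflTransGen (Rew R) (.app f ts) (.app f us) := by
  suffices ∀ ps : List (Term F V),
      Relation.ReflTransGen (Rew R) (.app f (ps ++ ts)) (.app f (ps ++ us)) from this []
  induction h with
  | nil => exact fun _ => .refl
  | @cons a b as bs hab _ ih =>
    intro ps
    refine (reflTransGen_rew_congr f ps as hab).trans ?_
    simpa using ih (ps ++ [b])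

theorem reflTransGen_rew_subst {σ τ : V → Term F V}
    (h : ∀ x, Relation.ReflTransGen (Rew R) (σ x) (τ x)) (t : Term F V) :
    Relation.ReflTransGen (Rew R) (t.subst σ) (t.subst τ) := by
  induction t using Term.induct with
  | var x => simpa [Term.subst] using h x
  | app f ts ih =>
    rw [Term.subst_app, Term.subst_app]
    apply reflTransGen_rew_app
    rw [List.forall₂_map_left_iff, List.forall₂_map_right_iff, List.forall₂_same]
    exact ih

theorem Rew.fill {u u' : Term F V} (h : Rew R u u') (K : Ctx F V) :
    Rew R (K.fill u) (K.fill u') := by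
  induction K with
  | hole => exact h
  | app f ts K us ih => exact .congr ih

theorem IRew.fill {u u' : Term F V} (h : IRew R u u') (K : Ctx F V) :
    IRew R (K.fill u) (K.fill u') := by
  induction K with
  | hole => exact h
  | app f ts K us ih => exact .congr ih

theorem exists_instance_of_rew {u u' : Term F V} (h : Rew R u u')
    (hu : ∀ v, PSub v u → NormalForm R v) :
    ∃ l r σ, (l, r) ∈ R ∧ u = Term.subst σ l ∧ u' = Term.subst σ r := by
  cases h with
  | root h => exact ⟨_, _, _, h, rfl, rfl⟩
  | congr h => exact absurd h (hu _ (.head (by simp)) _)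

theorem Rew.irew {u u' : Term F V} (h : Rew R u u')
    (hu : ∀ v, PSub v u → NormalForm R v) : IRew R u u' := by
  obtain ⟨l, r, σ, hlr, rfl, rfl⟩ := exists_instance_of_rew h hu
  exact .root hlr hu

theorem normalForm_of_psub {v s : Term F V} (h : PSub v s) (hs : NormalForm R s) :
    NormalForm R v := by
  induction h with
  | head hm =>
    obtain ⟨as, bs, rfl⟩ := List.append_of_mem hm
    exact fun u hu => hs _ (.congr hu)
  | tail _ hm ih =>
    obtain ⟨as, bs, rfl⟩ := List.append_of_mem hm
    exact ih fun u hu => hs _ (.congr hu)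

/-- A reducible term contains a reducible subterm whose proper subterms are normal forms. -/
theorem exists_innermost_redex (s : Term F V) (hs : ¬ NormalForm R s) :
    ∃ (K : Ctx F V) (u : Term F V), s = K.fill u ∧ ¬ NormalForm R u ∧
      ∀ v, PSub v u → NormalForm R v := by
  induction s using Term.induct with
  | var x => exact ⟨.hole, _, rfl, hs, fun v hv => nomatch hv⟩
  | app f ts ih =>
    by_cases h : ∀ t ∈ ts, NormalForm R t
    · refine ⟨.hole, _, rfl, hs, fun v hv => ?_⟩
      cases hv with
      | head hm => exact h _ hm
      | tail hv hm => exact normalForm_of_psub hv (h _ hm)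
    · push Not at h
      obtain ⟨t, ht, hn⟩ := h
      obtain ⟨K, u, rfl, hu⟩ := ih t ht hn
      obtain ⟨as, bs, rfl⟩ := List.append_of_mem ht
      exact ⟨.app f as K bs, u, rfl, hu⟩

theorem Term.subst_congr {σ τ : V → Term F V} (t : Term F V)
    (h : ∀ x ∈ t.varOccs, σ x = τ x) : t.subst σ = t.subst τ := by
  induction t using Term.induct with
  | var x => simpa [Term.subst, Term.varOccs] using h
  | app f ts ih =>
    rw [Term.subst_app, Term.subst_app]
    congr 1
    refine List.map_congr_left fun t ht => ih t ht fun x hx => h x ?_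
    rw [Term.varOccs_app]
    exact List.mem_flatten_of_mem (List.mem_map_of_mem ht) hx

open Classical in
theorem Term.subst_update_of_notMem {σ : V → Term F V} {t : Term F V} {x : V}
    (hx : x ∉ t.varOccs) (a : Term F V) :
    t.subst (Function.update σ x a) = t.subst σ :=
  t.subst_congr fun y hy => Function.update_of_ne (fun h => hx (by rwa [← h])) _ _

open Classical in
/-- Instances of a linear term depend on the value at an occurring variable through
a one-hole context. -/
theorem Term.Linear.exists_ctx {t : Term F V} (ht : t.Linear) {x : V} (hx : x ∈ t.varOccs)
    (σ : V → Term F V) (K : Ctx F V) :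
    ∃ K' : Ctx F V, ∀ z, t.subst (Function.update σ x (K.fill z)) = K'.fill z := by
  induction t using Term.induct with
  | var y =>
    obtain rfl : x = y := by simpa [Term.varOccs] using hx
    exact ⟨K, fun z => by simp [Term.subst]⟩
  | app f ts ih =>
    rw [Term.Linear, Term.varOccs_app] at ht
    rw [Term.varOccs_app, List.mem_flatten] at hx
    obtain ⟨_, hl, hx⟩ := hx
    obtain ⟨t, hm, rfl⟩ := List.mem_map.1 hl
    obtain ⟨as, bs, rfl⟩ := List.append_of_mem hm
    simp only [List.map_append, List.map_cons, List.flatten_append, List.flatten_cons,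
      List.nodup_append, List.mem_append] at ht
    obtain ⟨_, ⟨hnd, _, htb⟩, hat⟩ := ht
    obtain ⟨K', hK'⟩ := ih t hm hnd hx
    have has : ∀ s ∈ as, x ∉ s.varOccs := fun s hs h =>
      hat x (List.mem_flatten_of_mem (List.mem_map_of_mem hs) h) x (.inl hx) rfl
    have hbs : ∀ s ∈ bs, x ∉ s.varOccs := fun s hs h =>
      htb x hx x (List.mem_flatten_of_mem (List.mem_map_of_mem hs) h) rfl
    refine ⟨.app f (as.map (Term.subst σ)) K' (bs.map (Term.subst σ)), fun z => ?_⟩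
    rw [Term.subst_app, List.map_append, List.map_cons, hK', Ctx.fill,
      List.map_congr_left fun s hs => Term.subst_update_of_notMem (has s hs) _,
      List.map_congr_left fun s hs => Term.subst_update_of_notMem (hbs s hs) _]

open Classical in
/-- If `u` is not an instance of a proper non-variable subterm of `l`, then an occurrence of `u`
in an instance of `l` lies in the substitution part, unless it is at the root. -/
theorem exists_ctx_of_subst_eq_fill {u : Term F V} {σ : V → Term F V} (K : Ctx F V)
    (l : Term F V) (hl : ∀ v, PSub v l → ¬ v.IsVar → v.subst σ ≠ u)
    (h : l.subst σ = K.fill u) :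
    (K = .hole ∧ ¬ l.IsVar) ∨ ∃ (x : V) (K' : Ctx F V), σ x = K'.fill u ∧
      ∀ u', Rew R u u' → Relation.ReflTransGen (Rew R) (K.fill u')
        (l.subst (Function.update σ x (K'.fill u'))) := by
  induction K generalizing l with
  | hole =>
    cases l with
    | var x =>
      exact .inr ⟨x, .hole, by simpa [Term.subst] using h, fun u' _ => by
        simpa [Term.subst] using Relation.ReflTransGen.refl⟩
    | app f ls => exact .inl ⟨rfl, id⟩
  | app f ts K us ih =>
    right
    cases l with
    | var x =>
      exact ⟨x, .app f ts K us, by simpa [Term.subst] using h, fun u' _ => by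
        simpa [Term.subst] using Relation.ReflTransGen.refl⟩
    | app g ls =>
      rw [Term.subst_app, Ctx.fill, Term.app.injEq, List.map_eq_append_iff] at h
      obtain ⟨rfl, as, bs', rfl, rfl, h⟩ := h
      rw [List.map_eq_cons_iff] at h
      obtain ⟨m, bs, rfl, hm, rfl⟩ := h
      have hmem : m ∈ as ++ m :: bs := by simp
      rcases ih m (fun v hv => hl v (.tail hv hmem)) hm with ⟨rfl, hv⟩ | ⟨x, K', hx, hK'⟩
      · exact absurd hm (hl m (.head hmem) hv)
      · refine ⟨x, K', hx, fun u' hu' => ?_⟩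
        have hσ : ∀ y, Relation.ReflTransGen (Rew R) (σ y)
            (Function.update σ x (K'.fill u') y) := by
          intro y
          rcases eq_or_ne y x with rfl | hy
          · rw [Function.update_self, hx]
            exact .single (hu'.fill K')
          · rw [Function.update_of_ne hy]
        rw [Term.subst_app, List.map_append, List.map_cons]
        refine (reflTransGen_rew_congr _ _ _ (hK' u' hu')).trans (reflTransGen_rew_app _ ?_)
        refine List.rel_append ?_ (.cons .refl ?_) <;>
        · rw [List.forall₂_map_left_iff, List.forall₂_map_right_iff, List.forall₂_same]
          exact fun t _ => reflTransGen_rew_subst hσ t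

/-- A rewrite step from a term containing an innermost redex `u` either is simulated after
contracting `u`, or leaves exactly one residual of the chosen occurrence of `u`. -/
theorem rew_fill_innermost_redex (hRL : RightLinear R) (hOV : Overlay R)
    {u : Term F V} (hu : ¬ NormalForm R u) (hin : ∀ v, PSub v u → NormalForm R v)
    (K : Ctx F V) (s : Term F V) (h : Rew R (K.fill u) s) :
    (∃ u', Rew R u u' ∧ Relation.ReflTransGen (Rew R) (K.fill u') s) ∨
    ∃ K' : Ctx F V, s = K'.fill u ∧
      ∀ u', Rew R u u' → Relation.ReflTransGen (Rew R) (K.fill u') (K'.fill u') := by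
  classical
  induction K generalizing s with
  | hole => exact .inl ⟨s, h, .refl⟩
  | app f ts K us ih =>
    generalize hw : (Ctx.app f ts K us).fill u = w at h
    cases h with
    | @root l r σ hlr =>
      have hnu : ∃ u', Rew R u u' := by simpa [NormalForm] using hu
      obtain ⟨u₀, hu₀⟩ := hnu
      obtain ⟨l', r', τ, hlr', rfl, -⟩ := exists_instance_of_rew hu₀ hin
      rcases exists_ctx_of_subst_eq_fill (R := R) _ l
          (fun v hv hvar he => hOV ⟨l, r, l', r', v, hlr, hlr', hv, hvar, σ, τ, he⟩) hw.symm with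
        ⟨hK, -⟩ | ⟨x, K', hx, hK'⟩
      · cases hK
      · by_cases hxr : x ∈ r.varOccs
        · obtain ⟨K₂, hK₂⟩ := (hRL _ hlr).exists_ctx hxr σ K'
          refine .inr ⟨K₂, ?_, fun u' hu' => ?_⟩
          · rw [← hK₂, ← hx, Function.update_eq_self]
          · rw [← hK₂]
            exact (hK' u' hu').tail (.root hlr)
        · refine .inl ⟨u₀, hu₀, ?_⟩
          rw [← Term.subst_update_of_notMem hxr (K'.fill u₀)]
          exact (hK' u₀ hu₀).tail (.root hlr)
    | @congr a b g as bs hab =>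
      rw [Ctx.fill, Term.app.injEq, List.append_eq_append_iff] at hw
      obtain ⟨rfl, ⟨cs, rfl, h⟩ | ⟨cs, rfl, h⟩⟩ := hw
      · cases cs with
        | nil =>
          simp only [List.nil_append, List.cons.injEq] at h
          obtain ⟨rfl, rfl⟩ := h
          rw [List.append_nil]
          rcases ih b hab with ⟨u', hu', h⟩ | ⟨K', rfl, h⟩
          · exact .inl ⟨u', hu', reflTransGen_rew_congr _ _ _ h⟩
          · exact .inr ⟨.app f ts K' us, rfl, fun u' hu' => reflTransGen_rew_congr _ _ _ (h u' hu')⟩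
        | cons c cs =>
          simp only [List.cons_append, List.cons.injEq] at h
          obtain ⟨rfl, rfl⟩ := h
          refine .inr ⟨.app f ts K (cs ++ b :: bs), by simp [Ctx.fill], fun u' _ => .single ?_⟩
          simpa [Ctx.fill] using
            Rew.congr (f := f) (ts := ts ++ K.fill u' :: cs) (us := bs) hab
      · cases cs with
        | nil =>
          simp only [List.nil_append, List.cons.injEq] at h
          obtain ⟨rfl, rfl⟩ := h
          rw [List.append_nil] at *
          rcases ih b hab with ⟨u', hu', h⟩ | ⟨K', rfl, h⟩
          · exact .inl ⟨u', hu', reflTransGen_rew_congr _ _ _ h⟩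
          · exact .inr ⟨.app f as K' bs, rfl, fun u' hu' => reflTransGen_rew_congr _ _ _ (h u' hu')⟩
        | cons c cs =>
          simp only [List.cons_append, List.cons.injEq] at h
          obtain ⟨rfl, rfl⟩ := h
          refine .inr ⟨.app f (as ++ b :: cs) K us, by simp [Ctx.fill], fun u' _ => .single ?_⟩
          simpa [Ctx.fill] using
            Rew.congr (f := f) (ts := as) (us := cs ++ K.fill u' :: us) hab

/-- An innermost redex can be contracted in a suitable way without losing reachability of a
given normal form. -/
theorem exists_contraction_of_reaches_normalForm (hRL : RightLinear R)
    (hOV : Overlay R) {u t : Term F V} (hu : ¬ NormalForm R u)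
    (hin : ∀ v, PSub v u → NormalForm R v) (hNF : NormalForm R t) (K : Ctx F V)
    (h : Relation.ReflTransGen (Rew R) (K.fill u) t) :
    ∃ u', Rew R u u' ∧ Relation.ReflTransGen (Rew R) (K.fill u') t := by
  generalize hs : K.fill u = s at h
  induction h using Relation.ReflTransGen.head_induction_on generalizing K with
  | refl =>
    subst hs
    exact absurd (fun u' hu' => hNF _ (hu'.fill K)) hu
  | head hstep hrest ih =>
    subst hs
    rcases rew_fill_innermost_redex hRL hOV hu hin K _ hstep with
      ⟨u', hu', h⟩ | ⟨K', rfl, h⟩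
    · exact ⟨u', hu', h.trans hrest⟩
    · obtain ⟨u', hu', h'⟩ := ih K' rfl
      exact ⟨u', hu', (h u' hu').trans h'⟩

theorem TerminatingTRS.wellFounded (h : TerminatingTRS R) :
    WellFounded fun s t : Term F V => Rew R t s := by
  rw [wellFounded_iff_isEmpty_descending_chain]
  exact ⟨fun ⟨f, hf⟩ => h ⟨f, hf⟩⟩

end Innermost

/-- For a terminating right-linear overlay TRS `R`:
if `s →_R* t` and `t` is a normal form of `R`, then `s i→_R* t`. -/
theorem rewrite_to_nf_innermost_of_terminating_rightLinear_overlay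
    {F V : Type} {R : Set (Term F V × Term F V)}
    (hTRS : IsTRS R) (hSN : TerminatingTRS R)
    (hRL : RightLinear R) (hOV : Overlay R)
    (s t : Term F V)
    (hst : Relation.ReflTransGen (Rew R) s t)
    (hNF : NormalForm R t) :
    Relation.ReflTransGen (IRew R) s t := by
  induction s using hSN.wellFounded.induction with
  | h s ih =>
    by_cases hs : NormalForm R s
    · rcases hst.cases_head with rfl | ⟨_, h, _⟩
      · exact .refl
      · exact absurd h (hs _)
    · obtain ⟨K, u, rfl, hu, hin⟩ := exists_innermost_redex s hs
      obtain ⟨u', hu', h⟩ :=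
        exists_contraction_of_reaches_normalForm hRL hOV hu hin hNF K hst
      exact .head ((hu'.irew hin).fill K) (ih _ (hu'.fill K) h)

end RWS
end

section
/- A term rewrite system R is terminating if and only if there is no infinite minimal (DP(R),R)-chain. -/
namespace RWS

namespace Term

variable {F V : Type}

@[simp] theorem subst_var (σ : V → Term F V) (x : V) : (var x : Term F V).subst σ = σ x := by
  rw [subst]

@[simp] theorem subst_app_s2 (σ : V → Term F V) (f : F) (ts : List (Term F V)) :
    (app f ts).subst σ = app f (ts.map (subst σ)) := by
  rw [subst]; simp

@[simp] theorem lift_var (x : V) : (var x : Term F V).lift = var x := by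
  rw [lift]

@[simp] theorem lift_app (f : F) (ts : List (Term F V)) :
    (app f ts).lift = app (Sum.inl f) (ts.map lift) := by
  rw [lift]; simp

@[simp] theorem sharp_app (f : F) (ts : List (Term F V)) :
    (app f ts).sharp = app (Sum.inr f) (ts.map lift) := by
  rw [sharp]; simp

theorem mem_varOccs_app {x : V} {f : F} {ts : List (Term F V)} :
    x ∈ (app f ts).varOccs ↔ ∃ t ∈ ts, x ∈ t.varOccs := by
  rw [varOccs]; simp

/-- Structural induction on terms, with the hypothesis available for every argument. -/
theorem induct_s2 {P : Term F V → Prop} (hvar : ∀ x, P (var x))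
    (happ : ∀ f ts, (∀ t ∈ ts, P t) → P (app f ts)) : ∀ t, P t
  | var x => hvar x
  | app f ts => happ f ts fun t _ => induct_s2 hvar happ t

/-- Identify each tuple symbol `f#` with the original symbol `f`. -/
def erase : Term (F ⊕ F) V → Term F V
  | var x => var x
  | app f ts => app (Sum.elim id id f) (ts.attach.map fun t => t.1.erase)
decreasing_by
  simp_wf
  have := List.sizeOf_lt_of_mem t.2
  omega

@[simp] theorem erase_var (x : V) : (var x : Term (F ⊕ F) V).erase = var x := by
  rw [erase]

@[simp] theorem erase_app (f : F ⊕ F) (ts : List (Term (F ⊕ F) V)) :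
    (app f ts).erase = app (Sum.elim id id f) (ts.map erase) := by
  rw [erase]; simp

@[simp] theorem erase_lift (t : Term F V) : t.lift.erase = t := by
  induction t using induct_s2 with
  | hvar x => simp
  | happ f ts ih =>
    have h : ts.map (fun t => t.lift.erase) = ts.map fun t => t := List.map_congr_left ih
    simpa [Function.comp_def] using h

@[simp] theorem erase_sharp (t : Term F V) : t.sharp.erase = t := by
  cases t with
  | var x => simp [sharp]
  | app f ts => simp [Function.comp_def]

theorem erase_subst (σ : V → Term (F ⊕ F) V) (t : Term (F ⊕ F) V) :
    (t.subst σ).erase = t.erase.subst fun x => (σ x).erase := by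
  induction t using induct_s2 with
  | hvar x => simp
  | happ f ts ih => simpa using ih

theorem lift_subst (σ : V → Term F V) (t : Term F V) :
    (t.subst σ).lift = t.lift.subst fun x => (σ x).lift := by
  induction t using induct_s2 with
  | hvar x => simp
  | happ f ts ih => simpa using ih

theorem sharp_subst (σ : V → Term F V) (f : F) (ts : List (Term F V)) :
    ((app f ts).subst σ).sharp = (app f ts).sharp.subst fun x => (σ x).lift := by
  simp [lift_subst]

theorem exists_eq_app_of_not_isVar {t : Term F V} (h : ¬ t.IsVar) : ∃ f ts, t = app f ts := by
  cases t with
  | var x => exact (h trivial).elim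
  | app f ts => exact ⟨f, ts, rfl⟩

end Term

variable {F V : Type} {R : Set (Term F V × Term F V)}

theorem PSub.trans {s t u : Term F V} (hst : PSub s t) (htu : PSub t u) : PSub s u := by
  induction htu with
  | head h => exact .tail hst h
  | tail _ h ih => exact .tail ih h

theorem Sub.trans {s t u : Term F V} (hst : Sub s t) (htu : Sub t u) : Sub s u := by
  rcases hst with rfl | hst
  · exact htu
  · rcases htu with rfl | htu
    · exact .inr hst
    · exact .inr (hst.trans htu)

theorem Sub.of_mem {s t : Term F V} {f : F} {ts : List (Term F V)} (hs : Sub s t) (ht : t ∈ ts) :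
    Sub s (.app f ts) :=
  hs.trans (.inr (.head ht))

theorem Sub.subst {s t : Term F V} (h : Sub s t) (σ : V → Term F V) :
    Sub (s.subst σ) (t.subst σ) := by
  rcases h with rfl | h
  · exact .inl rfl
  · refine .inr ?_
    induction h with
    | head h => rw [Term.subst_app_s2]; exact .head (List.mem_map_of_mem h)
    | tail _ h ih => rw [Term.subst_app_s2]; exact .tail ih (List.mem_map_of_mem h)

/-- A rewrite step in a subterm extends to the whole term. -/
theorem Rew.exists_of_sub {a b m : Term F V} (hab : Rew R a b) (h : Sub a m) :
    ∃ m', Rew R m m' ∧ Sub b m' := by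
  rcases h with rfl | h
  · exact ⟨b, hab, .inl rfl⟩
  · induction h with
    | head h =>
      obtain ⟨xs, ys, rfl⟩ := List.append_of_mem h
      exact ⟨_, .congr hab, .of_mem (.inl rfl) (by simp)⟩
    | tail _ h ih =>
      obtain ⟨m', hm, hb⟩ := ih
      obtain ⟨xs, ys, rfl⟩ := List.append_of_mem h
      exact ⟨_, .congr hm, hb.of_mem (by simp)⟩

theorem exists_reflTransGen_of_sub {a b m : Term F V} (hab : Relation.ReflTransGen (Rew R) a b)
    (h : Sub a m) : ∃ m', Relation.ReflTransGen (Rew R) m m' ∧ Sub b m' := by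
  induction hab with
  | refl => exact ⟨m, .refl, h⟩
  | tail _ hbc ih =>
    obtain ⟨m', hm, hb⟩ := ih
    obtain ⟨m'', hm', hc⟩ := hbc.exists_of_sub hb
    exact ⟨m'', hm.tail hm', hc⟩

/-- Strong normalization, as accessibility for the converse of the rewrite relation. -/
def SN (R : Set (Term F V × Term F V)) (t : Term F V) : Prop :=
  Acc (fun b a => Rew R a b) t

theorem SN.terminating {t : Term F V} (h : SN R t) : Terminating R t := by
  induction h with
  | intro t _ ih =>
    rintro ⟨f, rfl, hf⟩
    exact ih (f 1) (hf 0) ⟨fun n => f (n + 1), rfl, fun n => hf (n + 1)⟩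

theorem exists_rew_not_SN {t : Term F V} (h : ¬ SN R t) : ∃ u, Rew R t u ∧ ¬ SN R u := by
  by_contra! hc
  exact h ⟨t, hc⟩

theorem terminatingTRS_iff_forall_SN : TerminatingTRS R ↔ ∀ t, SN R t := by
  constructor
  · intro h t
    by_contra ht
    choose next hstep hnext using
      fun s : { s : Term F V // ¬ SN R s } => exists_rew_not_SN s.2
    let f : ℕ → { s : Term F V // ¬ SN R s } :=
      fun n => Nat.rec ⟨t, ht⟩ (fun _ s => ⟨next s, hnext s⟩) n
    exact h ⟨fun n => (f n).1, fun n => hstep (f n)⟩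
  · rintro h ⟨f, hf⟩
    exact (h (f 0)).terminating ⟨f, rfl, hf⟩

theorem SN.of_rew {a b : Term F V} (h : SN R a) (hab : Rew R a b) : SN R b :=
  Acc.inv h hab

theorem SN.of_mem {f : F} {ts : List (Term F V)} {t : Term F V} (h : SN R (.app f ts))
    (ht : t ∈ ts) : SN R t := by
  obtain ⟨xs, ys, rfl⟩ := List.append_of_mem ht
  generalize hm : Term.app f (xs ++ t :: ys) = m at h
  clear ht
  induction h generalizing t with
  | intro m _ ih =>
    subst hm
    exact ⟨t, fun u hu => ih _ (.congr hu) rfl⟩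

theorem SN.of_mem_varOccs {σ : V → Term F V} {t : Term F V} {x : V} (h : SN R (t.subst σ))
    (hx : x ∈ t.varOccs) : SN R (σ x) := by
  induction t using Term.induct_s2 with
  | hvar y =>
    rw [Term.varOccs, List.mem_singleton] at hx
    simpa [hx] using h
  | happ f ts ih =>
    obtain ⟨t, ht, hxt⟩ := Term.mem_varOccs_app.1 hx
    rw [Term.subst_app_s2] at h
    exact ih t ht (h.of_mem (List.mem_map_of_mem ht)) hxt

/-- Rewriting exactly one element of a list of terms. -/
def ListStep (R : Set (Term F V × Term F V)) (xs ys : List (Term F V)) : Prop :=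
  ∃ ts us a b, Rew R a b ∧ xs = ts ++ a :: us ∧ ys = ts ++ b :: us

theorem listStep_cons {a : Term F V} {xs ys : List (Term F V)} (h : ListStep R (a :: xs) ys) :
    (∃ b, Rew R a b ∧ ys = b :: xs) ∨ ∃ zs, ListStep R xs zs ∧ ys = a :: zs := by
  obtain ⟨ts, us, c, d, hcd, h₁, rfl⟩ := h
  cases ts with
  | nil =>
    simp only [List.nil_append, List.cons.injEq] at h₁
    obtain ⟨rfl, rfl⟩ := h₁
    exact .inl ⟨d, hcd, rfl⟩
  | cons e ts =>
    simp only [List.cons_append, List.cons.injEq] at h₁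
    obtain ⟨rfl, rfl⟩ := h₁
    exact .inr ⟨_, ⟨ts, us, c, d, hcd, rfl, rfl⟩, rfl⟩

theorem acc_listStep : ∀ {xs : List (Term F V)}, (∀ x ∈ xs, SN R x) →
    Acc (fun ys xs => ListStep R xs ys) xs
  | [], _ => ⟨_, by rintro ys ⟨ts, us, a, b, -, h, -⟩; simp at h⟩
  | a :: xs, h => by
    have ha : SN R a := h a (by simp)
    have hxs := acc_listStep fun x hx => h x (List.mem_cons_of_mem a hx)
    clear h
    induction ha generalizing xs with
    | intro a ha iha =>
      induction hxs with
      | intro xs hxs ihxs =>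
        refine ⟨_, fun ys hys => ?_⟩
        rcases listStep_cons hys with ⟨b, hb, rfl⟩ | ⟨zs, hzs, rfl⟩
        · exact iha b hb xs ⟨xs, hxs⟩
        · exact ihxs zs hzs

theorem ListStep.forall_SN {xs ys : List (Term F V)} (h : ListStep R xs ys)
    (hxs : ∀ x ∈ xs, SN R x) : ∀ y ∈ ys, SN R y := by
  obtain ⟨ts, us, a, b, hab, rfl, rfl⟩ := h
  intro y hy
  simp only [List.mem_append, List.mem_cons] at hy hxs
  rcases hy with hy | rfl | hy
  · exact hxs y (.inl hy)
  · exact (hxs a (.inr (.inl rfl))).of_rew hab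
  · exact hxs y (.inr (.inr hy))

theorem Rew.root_or_listStep {f : F} {ts : List (Term F V)} {t : Term F V}
    (h : Rew R (.app f ts) t) :
    RootStep R (.app f ts) t ∨ ∃ us, ListStep R ts us ∧ t = .app f us := by
  generalize hm : Term.app f ts = m at h
  cases h with
  | @root l r σ h => exact .inl ⟨l, r, σ, h, rfl, rfl⟩
  | @congr a b g xs ys h =>
    obtain ⟨rfl, rfl⟩ := Term.app.inj hm
    exact .inr ⟨_, ⟨xs, ys, a, b, h, rfl, rfl⟩, rfl⟩

/-- `f(ts)` is not strongly normalizing although all its arguments are. -/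
def MinNonSN (R : Set (Term F V × Term F V)) (f : F) (ts : List (Term F V)) : Prop :=
  (∀ t ∈ ts, SN R t) ∧ ¬ SN R (.app f ts)

/-- A minimal non-terminating term admits a root step to a non-terminating term after
finitely many steps below the root. -/
theorem MinNonSN.exists_root {f : F} {ts : List (Term F V)} (h : MinNonSN R f ts) :
    ∃ us r σ l, Relation.ReflTransGen (ListStep R) ts us ∧ (∀ u ∈ us, SN R u) ∧
      (l, r) ∈ R ∧ Term.app f us = l.subst σ ∧ ¬ SN R (r.subst σ) := by
  induction acc_listStep h.1 with
  | intro ts _ ih =>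
    obtain ⟨t, ht, hnt⟩ := exists_rew_not_SN h.2
    rcases ht.root_or_listStep with ⟨l, r, σ, hlr, hl, rfl⟩ | ⟨us, hus, rfl⟩
    · exact ⟨ts, r, σ, l, .refl, h.1, hlr, hl, hnt⟩
    · obtain ⟨vs, r, σ, l, hvs, hrest⟩ := ih us hus ⟨hus.forall_SN h.1, hnt⟩
      exact ⟨vs, r, σ, l, .head hus hvs, hrest⟩

/-- A non-terminating instance of a term by a substitution that is terminating on its variables
contains a minimal non-terminating instance of a non-variable subterm. -/
theorem exists_minNonSN_subst {σ : V → Term F V} {t : Term F V} (ht : ¬ SN R (t.subst σ))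
    (hσ : ∀ x ∈ t.varOccs, SN R (σ x)) :
    ∃ g us, Sub (.app g us) t ∧ MinNonSN R g (us.map (Term.subst σ)) := by
  induction t using Term.induct_s2 with
  | hvar x => exact (ht (by simpa using hσ x (by simp [Term.varOccs]))).elim
  | happ f ts ih =>
    by_cases h : ∀ t ∈ ts, SN R (t.subst σ)
    · exact ⟨f, ts, .inl rfl, by simpa using h, by simpa using ht⟩
    · push Not at h
      obtain ⟨t, hts, hnt⟩ := h
      obtain ⟨g, us, hsub, hmin⟩ :=
        ih t hts hnt fun x hx => hσ x (Term.mem_varOccs_app.2 ⟨t, hts, hx⟩)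
      exact ⟨g, us, hsub.of_mem hts, hmin⟩

theorem IsTRS.exists_minNonSN (hTRS : IsTRS R) {t : Term F V} (ht : ¬ SN R t) :
    ∃ f ts, MinNonSN R f ts := by
  induction t using Term.induct_s2 with
  | hvar x =>
    obtain ⟨u, hu, -⟩ := exists_rew_not_SN ht
    generalize hm : Term.var x = m at hu
    cases hu with
    | @root l r σ h =>
      obtain ⟨f, ts, rfl⟩ := Term.exists_eq_app_of_not_isVar (hTRS _ h).1
      simp at hm
    | congr => cases hm
  | happ f ts ih =>
    by_cases h : ∀ t ∈ ts, SN R t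
    · exact ⟨f, ts, h, ht⟩
    · push Not at h
      obtain ⟨t, hts, hnt⟩ := h
      exact ih t hts hnt

/-- From a minimal non-terminating term one reaches, by steps below the root, an instance of a
left-hand side whose right-hand side has a non-variable subterm with a minimal non-terminating
instance. -/
theorem MinNonSN.exists_next (hTRS : IsTRS R) {f : F} {ts : List (Term F V)}
    (h : MinNonSN R f ts) :
    ∃ ls r σ g us, (Term.app f ls, r) ∈ R ∧
      Relation.ReflTransGen (ListStep R) ts (ls.map (Term.subst σ)) ∧
      Sub (.app g us) r ∧ MinNonSN R g (us.map (Term.subst σ)) := by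
  obtain ⟨vs, r, σ, l, hvs, hSN, hlr, hl, hr⟩ := h.exists_root
  obtain ⟨f', ls, rfl⟩ := Term.exists_eq_app_of_not_isVar (hTRS _ hlr).1
  rw [Term.subst_app_s2] at hl
  obtain ⟨rfl, rfl⟩ := Term.app.inj hl
  obtain ⟨g, us, hsub, hmin⟩ := exists_minNonSN_subst hr fun x hx => by
    obtain ⟨t, ht, hxt⟩ := Term.mem_varOccs_app.1 ((hTRS _ hlr).2 x hx)
    exact (hSN _ (List.mem_map_of_mem ht)).of_mem_varOccs hxt
  exact ⟨ls, r, σ, g, us, hlr, hvs, hsub, hmin⟩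

theorem MinNonSN.mem_definedSym (hTRS : IsTRS R) {f : F} {ts : List (Term F V)}
    (h : MinNonSN R f ts) : f ∈ DefinedSym R := by
  obtain ⟨ls, r, -, -, -, hlr, -⟩ := h.exists_next hTRS
  exact ⟨ls, r, hlr⟩

theorem Rew.lift {s t : Term F V} (h : Rew R s t) : Rew (liftTRS R) s.lift t.lift := by
  induction h with
  | root h =>
    rw [Term.lift_subst, Term.lift_subst]
    exact .root ⟨_, _, h, rfl⟩
  | congr _ ih => simpa using .congr ih

theorem Rew.erase {s t : Term (F ⊕ F) V} (h : Rew (liftTRS R) s t) : Rew R s.erase t.erase := by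
  induction h with
  | root h =>
    obtain ⟨l, r, hlr, h⟩ := h
    obtain ⟨rfl, rfl⟩ := Prod.mk.inj h
    simpa [Term.erase_subst] using .root hlr
  | congr _ ih => simpa using .congr ih

theorem SN.of_erase {t : Term (F ⊕ F) V} (h : SN R t.erase) : SN (liftTRS R) t :=
  Subrelation.accessible (fun h => Rew.erase h) (InvImage.accessible Term.erase h)

theorem reflTransGen_rew_sharp {xs ys : List (Term F V)} (f : F)
    (h : Relation.ReflTransGen (ListStep R) xs ys) :
    Relation.ReflTransGen (Rew (liftTRS R)) (Term.app f xs).sharp (Term.app f ys).sharp := by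
  induction h with
  | refl => exact .refl
  | tail _ h ih =>
    obtain ⟨ts, us, a, b, hab, rfl, rfl⟩ := h
    exact ih.tail (by simpa using .congr hab.lift)

/-- Terms rooted by a tuple symbol have no root steps, so they terminate as soon as their
arguments do. -/
theorem SN.app_inr (hTRS : IsTRS R) (f : F) {ts : List (Term (F ⊕ F) V)}
    (h : ∀ t ∈ ts, SN (liftTRS R) t) : SN (liftTRS R) (.app (Sum.inr f) ts) := by
  induction acc_listStep h with
  | intro ts _ ih =>
    refine ⟨_, fun t ht => ?_⟩
    rcases ht.root_or_listStep with ⟨_, _, σ, ⟨l, r, hlr, he⟩, hl, rfl⟩ | ⟨us, hus, rfl⟩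
    · obtain ⟨rfl, rfl⟩ := Prod.mk.inj he
      obtain ⟨g, ls, rfl⟩ := Term.exists_eq_app_of_not_isVar (hTRS _ hlr).1
      simp at hl
    · exact ih us hus (hus.forall_SN h)

theorem MinNonSN.terminating_sharp (hTRS : IsTRS R) {f : F} {ts : List (Term F V)}
    (h : MinNonSN R f ts) : Terminating (liftTRS R) (Term.app f ts).sharp := by
  rw [Term.sharp_app]
  refine (SN.app_inr hTRS f fun t ht => ?_).terminating
  obtain ⟨u, hu, rfl⟩ := List.mem_map.1 ht
  exact .of_erase (by simpa using h.1 u hu)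

/-- A minimal non-terminating term gives rise to an infinite minimal chain of dependency pairs. -/
theorem MinNonSN.exists_chain (hTRS : IsTRS R) {f : F} {ts : List (Term F V)}
    (h : MinNonSN R f ts) :
    ∃ (s t : ℕ → Term (F ⊕ F) V) (σ : ℕ → V → Term (F ⊕ F) V),
      (∀ i, (s i, t i) ∈ DP R) ∧
      (∀ i, Relation.ReflTransGen (Rew (liftTRS R))
        ((t i).subst (σ i)) ((s (i + 1)).subst (σ (i + 1)))) ∧
      (∀ i, Terminating (liftTRS R) ((t i).subst (σ i))) := by
  choose ls r σ g us hlr hred hsub hmin using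
    fun p : { p : F × List (Term F V) // MinNonSN R p.1 p.2 } => p.2.exists_next hTRS
  let p : ℕ → { p : F × List (Term F V) // MinNonSN R p.1 p.2 } :=
    fun n => Nat.rec ⟨(f, ts), h⟩ (fun _ p => ⟨(g p, (us p).map (Term.subst (σ p))), hmin p⟩) n
  refine ⟨fun i => (Term.app (p i).1.1 (ls (p i))).sharp,
    fun i => (Term.app (g (p i)) (us (p i))).sharp, fun i x => (σ (p i) x).lift,
    fun i => ⟨_, _, _, hlr (p i), hsub (p i), ⟨_, _, rfl, (hmin (p i)).mem_definedSym hTRS⟩, rfl⟩,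
    fun i => ?_, fun i => ?_⟩
  · rw [← Term.sharp_subst, ← Term.sharp_subst, Term.subst_app_s2, Term.subst_app_s2]
    exact reflTransGen_rew_sharp _ (hred (p (i + 1)))
  · rw [← Term.sharp_subst, Term.subst_app_s2]
    exact (hmin (p i)).terminating_sharp hTRS

/-- A terminating system admits no infinite chain of dependency pairs, minimal or not. -/
theorem not_exists_chain_of_forall_SN (hR : ∀ t, SN R t) {s t : ℕ → Term (F ⊕ F) V}
    {σ : ℕ → V → Term (F ⊕ F) V} (hDP : ∀ i, (s i, t i) ∈ DP R)
    (hred : ∀ i, Relation.ReflTransGen (Rew (liftTRS R))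
      ((t i).subst (σ i)) ((s (i + 1)).subst (σ (i + 1)))) : False := by
  suffices H : ∀ m i, ¬ Sub ((s i).subst (σ i)).erase m from H _ 0 (.inl rfl)
  intro m
  induction (hR m).transGen with
  | intro m _ ih =>
    intro i hi
    obtain ⟨l, r, u, hlr, hur, -, he⟩ := hDP i
    obtain ⟨hs, ht⟩ := Prod.mk.inj he
    have hred' : Relation.ReflTransGen (Rew R) ((t i).subst (σ i)).erase
        ((s (i + 1)).subst (σ (i + 1))).erase :=
      (hred i).lift Term.erase fun _ _ h => Rew.erase h
    rw [ht, Term.erase_subst, Term.erase_sharp] at hred'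
    rw [hs, Term.erase_subst, Term.erase_sharp] at hi
    obtain ⟨m₁, hm₁, hr⟩ := (Rew.root hlr).exists_of_sub hi
    obtain ⟨m₂, hm₂, hsub⟩ := exists_reflTransGen_of_sub hred' ((hur.subst _).trans hr)
    refine ih m₂ ?_ (i + 1) hsub
    rw [← Function.swap_def, Relation.transGen_swap]
    exact Relation.TransGen.head' hm₁ hm₂

/-- A TRS `R` is terminating iff there is no infinite minimal
`(DP(R),R)`-chain. -/
theorem terminating_iff_no_infinite_minimal_DP_chain
    {F V : Type} (R : Set (Term F V × Term F V)) (hTRS : IsTRS R) :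
    TerminatingTRS R ↔
      ¬ ∃ (s t : ℕ → Term (F ⊕ F) V) (σ : ℕ → V → Term (F ⊕ F) V),
          (∀ i, (s i, t i) ∈ DP R) ∧
          (∀ i, Relation.ReflTransGen (Rew (liftTRS R))
                  ((t i).subst (σ i)) ((s (i + 1)).subst (σ (i + 1)))) ∧
          (∀ i, Terminating (liftTRS R) ((t i).subst (σ i))) := by
  rw [terminatingTRS_iff_forall_SN]
  constructor
  · rintro hR ⟨s, t, σ, hDP, hred, -⟩
    exact not_exists_chain_of_forall_SN hR hDP hred
  · intro hno t
    by_contra ht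
    obtain ⟨f, ts, h⟩ := hTRS.exists_minNonSN ht
    exact hno (h.exists_chain hTRS)

end RWS
end

section
/- If a term s_0 is terminating w.r.t. a TRS R, then the relation ≻_st defined by s' ≻_st s'' iff s_0 (→_R ∪ ▷)* s' and s' (→_R ∪ ▷) s'' is well-founded, where ▷ is the proper-superterm-to-subterm relation. -/
namespace RWS

section Termination

variable {F V : Type} {R : Set (Term F V × Term F V)}

theorem PSub.sizeOf_lt {t u : Term F V} (h : PSub t u) : sizeOf t < sizeOf u := by
  induction h with
  | head h =>
    have := List.sizeOf_lt_of_mem h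
    simp only [Term.app.sizeOf_spec]
    omega
  | tail _ h ih =>
    have := List.sizeOf_lt_of_mem h
    simp only [Term.app.sizeOf_spec]
    omega

/-- A rewrite step in an argument extends to a rewrite step of the whole term. -/
theorem Rew.exists_app_of_mem {u v : Term F V} {ts : List (Term F V)} (f : F)
    (huv : Rew R u v) (hu : u ∈ ts) :
    ∃ vs, Rew R (.app f ts) (.app f vs) ∧ v ∈ vs := by
  obtain ⟨l, r, rfl⟩ := List.append_of_mem hu
  exact ⟨l ++ v :: r, .congr huv, by simp⟩

/-- The proper superterm relation commutes with rewriting: `▷ · →_R ⊆ →_R · ▷`. -/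
theorem PSub.exists_rew {u v t : Term F V} (hut : PSub u t) (huv : Rew R u v) :
    ∃ w, Rew R t w ∧ PSub v w := by
  induction hut with
  | head h =>
    obtain ⟨vs, hvs, hv⟩ := huv.exists_app_of_mem _ h
    exact ⟨_, hvs, .head hv⟩
  | tail _ h ih =>
    obtain ⟨w, hw, hvw⟩ := ih
    obtain ⟨ws, hws, hmem⟩ := hw.exists_app_of_mem _ h
    exact ⟨_, hws, .tail hvw hmem⟩

theorem Sub.exists_rew {u v t : Term F V} (hut : Sub u t) (huv : Rew R u v) :
    ∃ w, Rew R t w ∧ Sub v w := by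
  rcases hut with rfl | h
  · exact ⟨v, huv, .inl rfl⟩
  · obtain ⟨w, hw, hvw⟩ := h.exists_rew huv
    exact ⟨w, hw, .inr hvw⟩

theorem PSub.trans_sub {s t u : Term F V} (hst : PSub s t) (htu : Sub t u) : PSub s u := by
  rcases htu with rfl | h
  exacts [hst, hst.trans h]

theorem Terminating.acc {t : Term F V} (h : Terminating R t) :
    Acc (fun b a => Rew R a b) t := by
  by_contra hacc
  exact h (not_acc_iff_exists_descending_chain.mp hacc)

/-- Subterms of a term accessible for `→_R` are accessible for `→_R ∪ ▷`. -/
theorem acc_rew_or_pSub {t u : Term F V} (ht : Acc (fun b a => Rew R a b) t) (hut : Sub u t) :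
    Acc (fun b a => Rew R a b ∨ PSub b a) u := by
  induction ht generalizing u with
  | intro t _ ih =>
    induction hn : sizeOf u using Nat.strong_induction_on generalizing u with
    | _ n ihn =>
      subst hn
      refine ⟨_, fun v hv => ?_⟩
      rcases hv with hv | hv
      · obtain ⟨w, hw, hvw⟩ := hut.exists_rew hv
        exact ih w hw hvw
      · exact ihn _ hv.sizeOf_lt (.inr (hv.trans_sub hut)) rfl

end Termination

/-- If `s₀` is terminating w.r.t. `R`, then the relation
`≻_st`, defined by `s' ≻_st s''` iff `s₀ (→_R ∪ ▷)* s'` and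
`s' (→_R ∪ ▷) s''`, is well-founded (no infinite descending sequence). -/
theorem succ_st_wellFounded
    {F V : Type} (R : Set (Term F V × Term F V)) (s₀ : Term F V)
    (hSN : Terminating R s₀) :
    ¬ ∃ f : ℕ → Term F V, ∀ n : ℕ,
        Relation.ReflTransGen (fun a b => Rew R a b ∨ PSub b a) s₀ (f n) ∧
        (Rew R (f n) (f (n + 1)) ∨ PSub (f (n + 1)) (f n)) := by
  rintro ⟨f, hf⟩
  have hacc : Acc (fun b a => Rew R a b ∨ PSub b a) (f 0) := by
    have hreach := (hf 0).1
    generalize f 0 = t at hreach ⊢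
    induction hreach with
    | refl => exact acc_rew_or_pSub hSN.acc (.inl rfl)
    | tail _ hstep ih => exact ih.inv hstep
  exact not_acc_iff_exists_descending_chain.mpr ⟨f, rfl, fun n => (hf n).2⟩ hacc

end RWS
end
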